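/- arXiv:2207.14600 — 5 statements merged into one kernel-verified Lean document; each statement's English description precedes it below -/
import Mathlib

section
/- Let A be a Boolean algebra with more than two elements and m a strictly positive finitely additive probability measure on A. Then for every N there is no isometric embedding of the metric space (A, d_m) into the Euclidean space ℝ^N, i.e., there is no map f : A → ℝ^N with ‖f(a) − f(b)‖ = d_m(a,b) for all a, b ∈ A. -/
/-- The quadrilateral inequality in inner product spaces: the squares of the two diagonals sum to
at most the sum of the squares of the four sides. -/
theorem dist_sq_add_dist_sq_le_of_quadrilateral {E : Type*} [NormedAddCommGroup E]
    [InnerProductSpace ℝ E] (x y z w : E) :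
    dist x z ^ 2 + dist y w ^ 2 ≤ dist x y ^ 2 + dist y z ^ 2 + dist z w ^ 2 + dist w x ^ 2 := by
  have h := sq_nonneg ‖(x + z) - (y + w)‖
  simp only [dist_eq_norm, norm_sub_sq_real, norm_add_sq_real, inner_add_left,
    inner_add_right] at h ⊢
  linarith [real_inner_comm x y, real_inner_comm y z, real_inner_comm z w, real_inner_comm w x]


/-- A Boolean algebra with more than two elements, equipped with the Kolmogorov
metric of a strictly positive finitely additive probability measure, admits no isometric
embedding into any Euclidean space `ℝ^N`. -/
theorem no_isometric_embedding_of_boolean_algebra {A : Type*} [BooleanAlgebra A]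
    (hcard : ∃ x y z : A, x ≠ y ∧ y ≠ z ∧ x ≠ z)
    (m : A → ℝ)
    (h_top : m ⊤ = 1)
    (h_add : ∀ a b : A, a ⊓ b = ⊥ → m (a ⊔ b) = m a + m b)
    (h_pos : ∀ a : A, a ≠ ⊥ → 0 < m a) :
    ∀ N : ℕ, ¬ ∃ f : A → EuclideanSpace ℝ (Fin N),
      ∀ a b : A, dist (f a) (f b) = m ((a ⊓ bᶜ) ⊔ (aᶜ ⊓ b)) := by
  rintro N ⟨f, hf⟩
  obtain ⟨a, ha, ha'⟩ : ∃ a : A, a ≠ ⊥ ∧ a ≠ ⊤ := by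
    by_contra! h
    obtain ⟨x, y, z, hxy, hyz, hxz⟩ := hcard
    have h' (b : A) : b = ⊥ ∨ b = ⊤ := or_iff_not_imp_left.mpr (h b)
    rcases h' x with rfl | rfl <;> rcases h' y with rfl | rfl <;>
      rcases h' z with rfl | rfl <;> contradiction
  have hp := h_pos a ha
  have hq := h_pos aᶜ (by simpa using ha')
  have hsum : m a + m aᶜ = 1 := by
    rw [← h_add a aᶜ (inf_compl_self a), sup_compl_eq_top, h_top]
  have h := dist_sq_add_dist_sq_le_of_quadrilateral (f ⊥) (f a) (f ⊤) (f aᶜ)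
  simp only [hf, compl_bot, compl_top, compl_compl, bot_inf_eq, top_inf_eq, inf_bot_eq,
    inf_top_eq, inf_idem, bot_sup_eq, sup_bot_eq, sup_compl_eq_top, h_top] at h
  nlinarith [mul_pos hp hq]
end

section
/- Let n ≥ 2 and let x₀, x₁, …, xₙ be positive real numbers. Then det M(x₀,…,xₙ) = 2^{n−1}·[ (Σ_{α=0}^{n} x₀⋯x̂_α⋯xₙ)² − (n−1)·(Σ_{α=0}^{n} x₀²⋯x̂_α²⋯xₙ²) ], where x̂_α means the factor x_α is omitted from the product x₀⋯xₙ. -/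
/-- The `n × n` matrix `M(x₀,…,xₙ)` with `(i,j)` entry `(x₀+xᵢ)²` if `i = j` and
`x₀² + x₀xᵢ + x₀xⱼ − xᵢxⱼ` if `i ≠ j`, where rows/columns are indexed by `1,…,n`. -/
def morganMatrix (n : ℕ) (x : Fin (n + 1) → ℝ) : Matrix (Fin n) (Fin n) ℝ :=
  Matrix.of fun i j =>
    if i = j then (x 0 + x i.succ) ^ 2
    else x 0 ^ 2 + x 0 * x i.succ + x 0 * x j.succ - x i.succ * x j.succ

open Matrix in
/-- Determinant of a diagonal matrix with nonzero entries perturbed by the rank-two matrix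
`c • a aᵀ - b bᵀ`. -/
theorem det_diagonal_add_rank_two {ι K : Type*} [Fintype ι] [DecidableEq ι] [Field K]
    (d a b : ι → K) (c : K) (hd : ∀ i, d i ≠ 0) :
    (Matrix.of fun i j => (if i = j then d i else 0) + (c * (a i * a j) - b i * b j)).det =
      (∏ i, d i) * ((1 + c * ∑ i, a i ^ 2 / d i) * (1 - ∑ i, b i ^ 2 / d i) +
        c * (∑ i, a i * b i / d i) ^ 2) := by
  have hfactor :
      (Matrix.of fun i j => (if i = j then d i else 0) + (c * (a i * a j) - b i * b j)) =
      diagonal d * (1 + (Matrix.of fun i => ![c * a i / d i, -b i / d i] : Matrix ι (Fin 2) K) *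
        (Matrix.of ![a, b] : Matrix (Fin 2) ι K)) := by
    ext i j
    have := hd i
    rw [diagonal_mul]
    simp only [of_apply, Matrix.add_apply, one_apply, mul_apply, Fin.sum_univ_two, cons_val_zero,
      cons_val_one]
    split_ifs <;> field_simp <;> ring
  rw [hfactor, det_mul, det_diagonal, det_one_add_mul_comm, det_fin_two]
  congr 1
  simp only [of_apply, Matrix.add_apply, one_apply, mul_apply, cons_val_zero, cons_val_one, if_true,
    zero_ne_one, one_ne_zero, if_false, zero_add]
  have haa : ∑ i, a i * (c * a i / d i) = c * ∑ i, a i ^ 2 / d i := by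
    rw [Finset.mul_sum]; exact Finset.sum_congr rfl fun i _ => by ring
  have hbb : ∑ i, b i * (-b i / d i) = -∑ i, b i ^ 2 / d i := by
    rw [← Finset.sum_neg_distrib]; exact Finset.sum_congr rfl fun i _ => by ring
  have hab : ∑ i, a i * (-b i / d i) = -∑ i, a i * b i / d i := by
    rw [← Finset.sum_neg_distrib]; exact Finset.sum_congr rfl fun i _ => by ring
  have hba : ∑ i, b i * (c * a i / d i) = c * ∑ i, a i * b i / d i := by
    rw [Finset.mul_sum]; exact Finset.sum_congr rfl fun i _ => by ring
  rw [haa, hbb, hab, hba]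
  ring

theorem sum_prod_erase_eq_prod_mul_sum_inv {ι K : Type*} [Fintype ι] [DecidableEq ι] [Field K]
    (f : ι → K) (hf : ∀ i, f i ≠ 0) :
    ∑ i, ∏ j ∈ Finset.univ.erase i, f j = (∏ i, f i) * ∑ i, (f i)⁻¹ := by
  rw [Finset.mul_sum]
  refine Finset.sum_congr rfl fun i _ => ?_
  rw [← Finset.mul_prod_erase _ _ (Finset.mem_univ i), mul_right_comm, mul_inv_cancel₀ (hf i),
    one_mul]

open Finset in
/-- Determinant formula for `M(x₀,…,xₙ)`:
`det M = 2^{n−1}·[ (Σ_α x₀⋯x̂_α⋯xₙ)² − (n−1)·(Σ_α x₀²⋯x̂_α²⋯xₙ²) ]`. -/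
theorem det_morganMatrix (n : ℕ) (hn : 2 ≤ n) (x : Fin (n + 1) → ℝ)
    (hx : ∀ α, 0 < x α) :
    (morganMatrix n x).det =
      2 ^ (n - 1) *
        ((∑ α : Fin (n + 1), ∏ β ∈ Finset.univ.erase α, x β) ^ 2 -
          ((n : ℝ) - 1) * ∑ α : Fin (n + 1), ∏ β ∈ Finset.univ.erase α, (x β) ^ 2) := by
  have hx0 : x 0 ≠ 0 := (hx 0).ne'
  have hxs (i : Fin n) : x i.succ ≠ 0 := (hx _).ne'
  have hM : morganMatrix n x = Matrix.of fun i j : Fin n =>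
      (if i = j then 2 * x i.succ ^ 2 else 0) +
        (2 * x 0 ^ 2 * (1 * 1) - (x 0 - x i.succ) * (x 0 - x j.succ)) := by
    ext i j
    simp only [morganMatrix, Matrix.of_apply]
    split_ifs with h
    · subst h; ring
    · ring
  rw [hM, det_diagonal_add_rank_two (fun i : Fin n => 2 * x i.succ ^ 2) (fun _ => 1)
      (fun i => x 0 - x i.succ) _ fun i => mul_ne_zero two_ne_zero (pow_ne_zero 2 (hxs i)),
    sum_prod_erase_eq_prod_mul_sum_inv x fun α => (hx α).ne',
    sum_prod_erase_eq_prod_mul_sum_inv (fun α => x α ^ 2) fun α => pow_ne_zero 2 (hx α).ne']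
  simp only [Fin.sum_univ_succ, Fin.prod_univ_succ, Finset.prod_mul_distrib, Finset.prod_pow,
    Finset.prod_const, Finset.card_univ, Fintype.card_fin]
  set s := ∑ i : Fin n, (x i.succ)⁻¹
  set q := ∑ i : Fin n, (x i.succ ^ 2)⁻¹
  have hA : ∑ i : Fin n, (1 : ℝ) ^ 2 / (2 * x i.succ ^ 2) = q / 2 := by
    rw [Finset.sum_div]
    exact Finset.sum_congr rfl fun i _ => by have := hxs i; field_simp
  have hB : ∑ i : Fin n, (x 0 - x i.succ) ^ 2 / (2 * x i.succ ^ 2) =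
      (x 0 ^ 2 * q - 2 * x 0 * s + n) / 2 := by
    have hn1 : (n : ℝ) = ∑ _i : Fin n, (1 : ℝ) := by simp
    rw [hn1, Finset.mul_sum, Finset.mul_sum, ← Finset.sum_sub_distrib, ← Finset.sum_add_distrib,
      Finset.sum_div]
    exact Finset.sum_congr rfl fun i _ => by have := hxs i; field_simp; ring
  have hC : ∑ i : Fin n, 1 * (x 0 - x i.succ) / (2 * x i.succ ^ 2) = (x 0 * q - s) / 2 := by
    rw [Finset.mul_sum, ← Finset.sum_sub_distrib, Finset.sum_div]
    exact Finset.sum_congr rfl fun i _ => by have := hxs i; field_simp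
  obtain ⟨m, rfl⟩ : ∃ m, n = m + 1 := ⟨n - 1, by omega⟩
  rw [hA, hB, hC, Nat.add_sub_cancel, pow_succ (2 : ℝ) m]
  field_simp
  ring
end

section
/- Let n ≥ 2 and let x₁,…,xₙ be nonzero real numbers. The adjugate of the n×n real matrix A with Aᵢⱼ = −2(1−δᵢⱼ)xᵢxⱼ is the matrix D with Dᵢⱼ = 2^{n−1}·x₁²⋯xₙ²·( 1/(xᵢxⱼ) − δᵢⱼ(n−1)/xᵢ² ). -/
open Matrix in
/-- The determinant of `1 - J`, where `J` is the all-ones matrix. -/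
theorem det_one_sub_ones {R ι : Type*} [CommRing R] [Fintype ι] [DecidableEq ι] :
    (1 - Matrix.of fun _ _ : ι => (1 : R)).det = 1 - (Fintype.card ι : R) := by
  have h : (1 - Matrix.of fun _ _ : ι => (1 : R)) =
      1 + replicateCol Unit (fun _ : ι => (-1 : R)) * replicateRow Unit (fun _ : ι => (1 : R)) := by
    ext i j
    simp [Matrix.mul_apply, sub_eq_add_neg]
  rw [h, det_one_add_replicateCol_mul_replicateRow]
  simp [dotProduct, sub_eq_add_neg]

/-- The square of the all-ones matrix `J` is `card ι • J`. -/
theorem ones_mul_ones {R ι : Type*} [CommRing R] [Fintype ι] :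
    (Matrix.of fun _ _ : ι => (1 : R)) * (Matrix.of fun _ _ : ι => (1 : R)) =
      (Fintype.card ι : R) • Matrix.of fun _ _ : ι => (1 : R) := by
  ext i j
  simp [Matrix.mul_apply]

/-- The adjugate of the `n × n` matrix `A` with `Aᵢⱼ = −2(1−δᵢⱼ)xᵢxⱼ`
(for nonzero `x₁,…,xₙ`) is the matrix `D` with
`Dᵢⱼ = 2^{n−1}·x₁²⋯xₙ²·( 1/(xᵢxⱼ) − δᵢⱼ(n−1)/xᵢ² )`. -/
theorem adjugate_offdiag_product_matrix (n : ℕ) (hn : 2 ≤ n) (x : Fin n → ℝ)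
    (hx : ∀ i, x i ≠ 0) :
    (Matrix.of fun i j : Fin n => if i = j then (0 : ℝ) else -2 * x i * x j).adjugate =
      Matrix.of fun i j : Fin n =>
        2 ^ (n - 1) * (∏ k : Fin n, (x k) ^ 2) *
          (1 / (x i * x j) - if i = j then ((n : ℝ) - 1) / (x i) ^ 2 else 0) := by
  set A := Matrix.of fun i j : Fin n => if i = j then (0 : ℝ) else -2 * x i * x j with hA
  set D := Matrix.of fun i j : Fin n => 2 ^ (n - 1) * (∏ k : Fin n, (x k) ^ 2) *
    (1 / (x i * x j) - if i = j then ((n : ℝ) - 1) / (x i) ^ 2 else 0) with hD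
  set J := Matrix.of fun _ _ : Fin n => (1 : ℝ) with hJ
  set c : ℝ := 2 ^ (n - 1) * ∏ k : Fin n, (x k) ^ 2 with hc
  set d := Matrix.diagonal x with hd
  set e := Matrix.diagonal (fun i => (x i)⁻¹) with he
  have hde : d * e = 1 := by
    simp [hd, he, Matrix.diagonal_mul_diagonal, hx]
  have hA' : A = (2 : ℝ) • (d * (1 - J) * d) := by
    ext i j
    by_cases h : i = j
    · simp [hA, hd, hJ, h]
    · simp [hA, hd, hJ, h, mul_assoc]
  have hD' : D = c • (e * (J - ((n : ℝ) - 1) • 1) * e) := by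
    ext i j
    by_cases h : i = j
    · subst h
      simp [hD, he, hJ, hc]
      left
      have := hx i
      field_simp
    · simp [hD, he, hJ, hc, h, mul_comm]
  have hJJ : J * J = (n : ℝ) • J := by
    rw [hJ, ones_mul_ones, Fintype.card_fin]
  have hdet : A.det = 2 * c * (1 - n) := by
    have h1 : (1 - J).det = 1 - (n : ℝ) := by
      simpa using det_one_sub_ones (R := ℝ) (ι := Fin n)
    have h2 : (2 : ℝ) ^ n = 2 * 2 ^ (n - 1) := by
      rw [← pow_succ', Nat.sub_add_cancel (by omega)]
    rw [hA', Matrix.det_smul, Matrix.det_mul, Matrix.det_mul, h1, hd, Matrix.det_diagonal, hc,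
      Finset.prod_pow, Fintype.card_fin, h2]
    ring
  have hmid : (1 - J) * (J - ((n : ℝ) - 1) • 1) = (1 - (n : ℝ)) • 1 := by
    rw [sub_mul, one_mul, mul_sub, hJJ, mul_smul_comm, mul_one]
    module
  have hAD : A * D = A.det • 1 := by
    calc A * D = (2 * c) • (d * (1 - J) * (d * e) * (J - ((n : ℝ) - 1) • 1) * e) := by
          rw [hA', hD', smul_mul_smul_comm]
          simp only [mul_assoc]
      _ = A.det • 1 := by
          rw [hde, mul_one, mul_assoc d, hmid, mul_smul_comm, mul_one, smul_mul_assoc, hde,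
            smul_smul, hdet]
  have hne : A.det ≠ 0 := by
    have hn' : (2 : ℝ) ≤ n := by exact_mod_cast hn
    have hc0 : c ≠ 0 :=
      mul_ne_zero (by positivity) (Finset.prod_ne_zero_iff.2 fun k _ => pow_ne_zero 2 (hx k))
    rw [hdet]
    exact mul_ne_zero (mul_ne_zero two_ne_zero hc0) (by linarith)
  have key : A.det • A.adjugate = A.det • D := by
    calc A.det • A.adjugate = A.adjugate * (A * D) := by rw [hAD, mul_smul_comm, mul_one]
      _ = A.det • D := by rw [← mul_assoc, Matrix.adjugate_mul, smul_mul_assoc, one_mul]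
  exact smul_right_injective _ hne key
end

section
/- Let K₁, K₂ ⊂ ℝ^{k+1} be compact sets, each star-shaped with respect to 0 with 0 in the interior of K₁, with K₁ contained in the interior of K₂, and such that every ray from the origin intersects the frontier of each Kᵢ (i = 1,2) in exactly one point. Then there exists a homeomorphism F from the closed annulus { x ∈ ℝ^{k+1} : 1 ≤ ‖x‖ ≤ 2 } onto K₂ \ int(K₁) mapping the sphere of radius 1 onto ∂K₁ and the sphere of radius 2 onto ∂K₂; in particular int(K₂) \ K₁ is homeomorphic to S^k × (0,1). -/
open Set Metric Topology

/-- A continuous positively homogeneous function that is positive away from the origin. -/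
structure IsRadialGauge {E : Type*} [NormedAddCommGroup E] [NormedSpace ℝ E] (p : E → ℝ) :
    Prop where
  continuous : Continuous p
  pos : ∀ x, x ≠ 0 → 0 < p x
  smul : ∀ (c : ℝ) (x : E), 0 ≤ c → p (c • x) = c * p x

/-- The position of `y` on its ray, measured affinely from the level set `p = 1` (position `0`)
to the level set `q = 1` (position `1`). -/
noncomputable def radialPosition {E : Type*} (p q : E → ℝ) (y : E) : ℝ :=
  q y * (p y - 1) / (p y - q y)

/-- The distance from the origin at which the ray through the unit vector `u` reaches
position `t` between the level sets `p = 1` and `q = 1`. -/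
noncomputable def radialDistance {E : Type*} (p q : E → ℝ) (u : E) (t : ℝ) : ℝ :=
  (1 - t) / p u + t / q u

section RadialPosition

variable {E : Type*} {p q : E → ℝ} {y : E}

theorem radialPosition_nonneg_iff (hq : 0 < q y) (hqp : q y < p y) :
    0 ≤ radialPosition p q y ↔ 1 ≤ p y := by
  rw [radialPosition, le_div_iff₀ (sub_pos.2 hqp), zero_mul, mul_nonneg_iff_of_pos_left hq,
    sub_nonneg]

theorem radialPosition_pos_iff (hq : 0 < q y) (hqp : q y < p y) :
    0 < radialPosition p q y ↔ 1 < p y := by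
  rw [radialPosition, lt_div_iff₀ (sub_pos.2 hqp), zero_mul, mul_pos_iff_of_pos_left hq, sub_pos]

theorem one_sub_radialPosition (hqp : q y < p y) :
    1 - radialPosition p q y = p y * (1 - q y) / (p y - q y) := by
  have := (sub_pos.2 hqp).ne'
  rw [radialPosition]
  field_simp
  ring

theorem radialPosition_le_one_iff (hq : 0 < q y) (hqp : q y < p y) :
    radialPosition p q y ≤ 1 ↔ q y ≤ 1 := by
  rw [← sub_nonneg, one_sub_radialPosition hqp, le_div_iff₀ (sub_pos.2 hqp), zero_mul,
    mul_nonneg_iff_of_pos_left (hq.trans hqp), sub_nonneg]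

theorem radialPosition_lt_one_iff (hq : 0 < q y) (hqp : q y < p y) :
    radialPosition p q y < 1 ↔ q y < 1 := by
  rw [← sub_pos, one_sub_radialPosition hqp, lt_div_iff₀ (sub_pos.2 hqp), zero_mul,
    mul_pos_iff_of_pos_left (hq.trans hqp), sub_pos]

theorem radialPosition_eq_zero_iff (hq : 0 < q y) (hqp : q y < p y) :
    radialPosition p q y = 0 ↔ p y = 1 := by
  rw [radialPosition, div_eq_zero_iff, mul_eq_zero, sub_eq_zero, sub_eq_zero]
  simp [hq.ne', hqp.ne']

theorem radialPosition_eq_one_iff (hq : 0 < q y) (hqp : q y < p y) :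
    radialPosition p q y = 1 ↔ q y = 1 := by
  rw [eq_comm, ← sub_eq_zero, one_sub_radialPosition hqp, div_eq_zero_iff, mul_eq_zero,
    sub_eq_zero, sub_eq_zero]
  simp [(hq.trans hqp).ne', hqp.ne', eq_comm]

theorem radialDistance_pos (hp : 0 < p y) (hq : 0 < q y) {t : ℝ} (ht : t ∈ Icc (0 : ℝ) 1) :
    0 < radialDistance p q y t := by
  rcases ht.2.eq_or_lt with rfl | h
  · simpa [radialDistance] using hq
  · exact add_pos_of_pos_of_nonneg (div_pos (sub_pos.2 h) hp) (div_nonneg ht.1 hq.le)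

end RadialPosition

section Radial

variable {E : Type*} [NormedAddCommGroup E] [NormedSpace ℝ E]

theorem isRadialGauge_norm : IsRadialGauge (norm : E → ℝ) where
  continuous := continuous_norm
  pos _ hx := norm_pos_iff.2 hx
  smul c x hc := by rw [norm_smul, Real.norm_of_nonneg hc]

theorem IsRadialGauge.div_const {p : E → ℝ} (hp : IsRadialGauge p) {r : ℝ} (hr : 0 < r) :
    IsRadialGauge fun x ↦ p x / r where
  continuous := hp.continuous.div_const r
  pos x hx := div_pos (hp.pos x hx) hr
  smul c x hc := by rw [hp.smul c x hc, mul_div_assoc]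

variable {p q : E → ℝ}

theorem radialPosition_radialDistance_smul (hp : IsRadialGauge p) (hq : IsRadialGauge q)
    (hqp : ∀ x, x ≠ 0 → q x < p x) {u : E} (hu : u ≠ 0) {t : ℝ} (ht : t ∈ Icc (0 : ℝ) 1) :
    radialPosition p q (radialDistance p q u t • u) = t := by
  have hpu := hp.pos u hu
  have hqu := hq.pos u hu
  have hd := radialDistance_pos hpu hqu ht
  have hsub := (sub_pos.2 (hqp u hu)).ne'
  rw [radialPosition, hp.smul _ _ hd.le, hq.smul _ _ hd.le, ← mul_sub, mul_assoc,
    mul_div_mul_left _ _ hd.ne', radialDistance]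
  field_simp
  ring

theorem radialDistance_radialPosition (hp : IsRadialGauge p) (hq : IsRadialGauge q)
    (hqp : ∀ x, x ≠ 0 → q x < p x) {y : E} (hy : y ≠ 0) :
    radialDistance p q (‖y‖⁻¹ • y) (radialPosition p q y) = ‖y‖ := by
  have hpy := (hp.pos y hy).ne'
  have hqy := (hq.pos y hy).ne'
  have hsub := (sub_pos.2 (hqp y hy)).ne'
  have hn := norm_ne_zero_iff.2 hy
  have hi : 0 ≤ ‖y‖⁻¹ := inv_nonneg.2 (norm_nonneg y)
  rw [radialDistance, one_sub_radialPosition (hqp y hy), radialPosition, hp.smul _ _ hi,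
    hq.smul _ _ hi]
  field_simp
  ring

/-- The region of points whose radial position lies in `T` is homeomorphic to the product of the
unit sphere with `T`. -/
noncomputable def radialHomeomorph (hp : IsRadialGauge p) (hq : IsRadialGauge q)
    (hqp : ∀ x, x ≠ 0 → q x < p x) {T : Set ℝ} (hT : T ⊆ Icc 0 1) {A : Set E}
    (hA : ∀ y, y ∈ A ↔ y ≠ 0 ∧ radialPosition p q y ∈ T) :
    A ≃ₜ sphere (0 : E) 1 × T where
  toFun y := (⟨‖(y : E)‖⁻¹ • (y : E), by
    simp [norm_smul, norm_ne_zero_iff.2 ((hA y).1 y.2).1]⟩,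
    ⟨radialPosition p q y, ((hA y).1 y.2).2⟩)
  invFun z := ⟨radialDistance p q z.1 z.2 • (z.1 : E), by
    have hu := ne_zero_of_mem_unit_sphere z.1
    refine (hA _).2 ⟨smul_ne_zero
      (radialDistance_pos (hp.pos _ hu) (hq.pos _ hu) (hT z.2.2)).ne' hu, ?_⟩
    rw [radialPosition_radialDistance_smul hp hq hqp hu (hT z.2.2)]
    exact z.2.2⟩
  left_inv y := by
    have hy := ((hA y).1 y.2).1
    ext1
    simp [radialDistance_radialPosition hp hq hqp hy, smul_smul, norm_ne_zero_iff.2 hy]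
  right_inv z := by
    have hu := ne_zero_of_mem_unit_sphere z.1
    have hd := radialDistance_pos (hp.pos _ hu) (hq.pos _ hu) (hT z.2.2)
    have hnorm : ‖(z.1 : E)‖ = 1 := by simp
    ext1 <;> ext1
    · simp only [norm_smul, hnorm, mul_one, Real.norm_of_nonneg hd.le, smul_smul,
        inv_mul_cancel₀ hd.ne', one_smul]
    · exact radialPosition_radialDistance_smul hp hq hqp hu (hT z.2.2)
  continuous_toFun := by
    have hy (y : A) := ((hA y).1 y.2).1
    have hcp := hp.continuous
    have hcq := hq.continuous
    refine .prodMk (.subtype_mk (.smul (.inv₀ (by fun_prop) fun y : A ↦ norm_ne_zero_iff.2 (hy y))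
      (by fun_prop)) _) (.subtype_mk (.div (by fun_prop) (by fun_prop)
      fun y : A ↦ (sub_pos.2 (hqp y (hy y))).ne') _)
  continuous_invFun := by
    have hu (z : sphere (0 : E) 1 × T) := ne_zero_of_mem_unit_sphere z.1
    have hcp := hp.continuous
    have hcq := hq.continuous
    refine .subtype_mk (.smul (.add (.div (by fun_prop) (by fun_prop) fun z ↦ ?_)
      (.div (by fun_prop) (by fun_prop) fun z ↦ ?_)) (by fun_prop)) _
    · exact (hp.pos _ (hu z)).ne'
    · exact (hq.pos _ (hu z)).ne'

theorem radialHomeomorph_apply_snd (hp : IsRadialGauge p) (hq : IsRadialGauge q)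
    (hqp : ∀ x, x ≠ 0 → q x < p x) {T : Set ℝ} (hT : T ⊆ Icc 0 1) {A : Set E}
    (hA : ∀ y, y ∈ A ↔ y ≠ 0 ∧ radialPosition p q y ∈ T) (y : A) :
    ((radialHomeomorph hp hq hqp hT hA y).2 : ℝ) = radialPosition p q y :=
  rfl

end Radial

section StarConvexGauge

variable {E : Type*} [NormedAddCommGroup E] [NormedSpace ℝ E] {K : Set E}

theorem gauge_le_one_iff_mem_of_starConvex (hK : IsClosed K) (hstar : StarConvex ℝ 0 K)
    (h0 : K ∈ 𝓝 0) {x : E} : gauge K x ≤ 1 ↔ x ∈ K := by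
  refine ⟨fun hx ↦ by_contra fun hxK ↦ ?_, gauge_le_one_of_mem⟩
  have hcont : Filter.Tendsto (fun c : ℝ ↦ c • x) (𝓝[<] 1) (𝓝 x) := by
    have : Continuous fun c : ℝ ↦ c • x := by fun_prop
    simpa using (this.tendsto 1).mono_left nhdsWithin_le_nhds
  obtain ⟨c, hcK, hc0, hc1⟩ := ((hcont.eventually (hK.isOpen_compl.mem_nhds hxK)).and
    (Ioo_mem_nhdsLT (zero_lt_one' ℝ))).exists
  have h := one_le_gauge_of_notMem hstar (absorbent_nhds_zero h0 _) hcK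
  rw [gauge_smul_of_nonneg hc0.le, smul_eq_mul] at h
  nlinarith

theorem gauge_inv_smul_self {x : E} (hx : 0 < gauge K x) :
    gauge K ((gauge K x)⁻¹ • x) = 1 := by
  rw [gauge_smul_of_nonneg (inv_nonneg.2 hx.le), smul_eq_mul, inv_mul_cancel₀ hx.ne']

theorem gauge_lt_one_iff_mem_interior_of_starConvex (hK : IsCompact K)
    (hstar : StarConvex ℝ 0 K) (h0 : K ∈ 𝓝 0)
    (hray : ∀ v : E, ‖v‖ = 1 → ∃! t : ℝ, 0 < t ∧ t • v ∈ frontier K) {x : E} :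
    gauge K x < 1 ↔ x ∈ interior K := by
  refine ⟨fun hx ↦ ?_, fun hx ↦ interior_subset_gauge_lt_one K hx⟩
  rcases eq_or_ne x 0 with rfl | hx0
  · exact mem_interior_iff_mem_nhds.2 h0
  have hg : 0 < gauge K x := (gauge_pos (absorbent_nhds_zero h0)
    ((NormedSpace.isVonNBounded_iff ℝ).2 hK.isBounded)).2 hx0
  have hmem {y : E} := gauge_le_one_iff_mem_of_starConvex hK.isClosed hstar h0 (x := y)
  by_contra hxi
  have hn : 0 < ‖x‖ := norm_pos_iff.2 hx0
  have hu : ‖(‖x‖⁻¹ • x)‖ = 1 := by simp [norm_smul, hn.ne']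
  have h1 : ‖x‖ • ‖x‖⁻¹ • x ∈ frontier K := by
    rw [smul_inv_smul₀ hn.ne']
    exact ⟨subset_closure (hmem.1 hx.le), hxi⟩
  have h2 : ((gauge K x)⁻¹ * ‖x‖) • ‖x‖⁻¹ • x ∈ frontier K := by
    rw [mul_smul, smul_inv_smul₀ hn.ne']
    have hone := gauge_inv_smul_self hg
    exact ⟨subset_closure (hmem.1 hone.le),
      fun hi ↦ (interior_subset_gauge_lt_one K hi).ne hone⟩
  have h := (hray _ hu).unique ⟨hn, h1⟩ ⟨mul_pos (inv_pos.2 hg) hn, h2⟩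
  exact (one_lt_inv₀ hg |>.2 hx).ne (mul_right_cancel₀ hn.ne' ((one_mul _).trans h))

theorem gauge_eq_one_iff_mem_frontier_of_starConvex (hK : IsCompact K)
    (hstar : StarConvex ℝ 0 K) (h0 : K ∈ 𝓝 0)
    (hray : ∀ v : E, ‖v‖ = 1 → ∃! t : ℝ, 0 < t ∧ t • v ∈ frontier K) {x : E} :
    gauge K x = 1 ↔ x ∈ frontier K := by
  rw [hK.isClosed.frontier_eq, mem_sdiff,
    ← gauge_le_one_iff_mem_of_starConvex hK.isClosed hstar h0,
    ← gauge_lt_one_iff_mem_interior_of_starConvex hK hstar h0 hray, not_lt, le_antisymm_iff]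

theorem isRadialGauge_gauge (hK : IsCompact K) (hstar : StarConvex ℝ 0 K) (h0 : K ∈ 𝓝 0)
    (hray : ∀ v : E, ‖v‖ = 1 → ∃! t : ℝ, 0 < t ∧ t • v ∈ frontier K) :
    IsRadialGauge (gauge K) where
  pos x hx := (gauge_pos (absorbent_nhds_zero h0)
    ((NormedSpace.isVonNBounded_iff ℝ).2 hK.isBounded)).2 hx
  smul c x hc := gauge_smul_of_nonneg hc x
  continuous := by
    have hscale {a : ℝ} (ha : 0 < a) (x : E) : gauge K (a⁻¹ • x) = a⁻¹ * gauge K x :=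
      gauge_smul_of_nonneg (inv_nonneg.2 ha.le) x
    refine continuous_iff_lower_upperSemicontinuous.2
      ⟨lowerSemicontinuous_iff_isOpen_preimage.2 fun a ↦ ?_,
      upperSemicontinuous_iff_isOpen_preimage.2 fun a ↦ ?_⟩
    · rcases lt_trichotomy a 0 with ha | rfl | ha
      · convert isOpen_univ
        exact eq_univ_of_forall fun x ↦ ha.trans_le (gauge_nonneg x)
      · convert isOpen_compl_singleton (x := (0 : E))
        ext x
        exact gauge_pos (absorbent_nhds_zero h0)
          ((NormedSpace.isVonNBounded_iff ℝ).2 hK.isBounded)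
      · convert hK.isClosed.isOpen_compl.preimage (continuous_const_smul a⁻¹)
        ext x
        rw [mem_preimage, mem_preimage, mem_compl_iff,
          ← gauge_le_one_iff_mem_of_starConvex hK.isClosed hstar h0, hscale ha,
          inv_mul_le_one₀ ha, not_le, mem_Ioi]
    · rcases le_or_gt a 0 with ha | ha
      · convert isOpen_empty
        exact eq_empty_of_forall_notMem fun x hx ↦ (ha.trans (gauge_nonneg x)).not_gt hx
      · convert (isOpen_interior (s := K)).preimage (continuous_const_smul a⁻¹)
        ext x
        rw [mem_preimage, mem_preimage,
          ← gauge_lt_one_iff_mem_interior_of_starConvex hK hstar h0 hray, hscale ha,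
          inv_mul_lt_one₀ ha, mem_Iio]

end StarConvexGauge

/-- Given compact sets `K₁ ⊂ int K₂` in `ℝ^{k+1}`, each star-shaped with respect
to `0`, with `0 ∈ int K₁`, such that every ray from the origin meets each frontier `∂Kᵢ` in
exactly one point, there is a homeomorphism from the closed annulus `{1 ≤ ‖x‖ ≤ 2}` onto
`K₂ \ int K₁` sending the sphere of radius `1` onto `∂K₁` and the sphere of radius `2` onto
`∂K₂`; in particular `int K₂ \ K₁ ≅ S^k × (0,1)`. -/
theorem starshaped_annulus_homeomorph (k : ℕ)
    (K₁ K₂ : Set (EuclideanSpace ℝ (Fin (k + 1))))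
    (h₁_compact : IsCompact K₁) (h₂_compact : IsCompact K₂)
    (h₁_star : StarConvex ℝ 0 K₁) (h₂_star : StarConvex ℝ 0 K₂)
    (h₁_int : (0 : EuclideanSpace ℝ (Fin (k + 1))) ∈ interior K₁)
    (h_sub : K₁ ⊆ interior K₂)
    (h₁_ray : ∀ v : EuclideanSpace ℝ (Fin (k + 1)), ‖v‖ = 1 →
      ∃! t : ℝ, 0 < t ∧ t • v ∈ frontier K₁)
    (h₂_ray : ∀ v : EuclideanSpace ℝ (Fin (k + 1)), ‖v‖ = 1 →
      ∃! t : ℝ, 0 < t ∧ t • v ∈ frontier K₂) :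
    (∃ F : ↥{x : EuclideanSpace ℝ (Fin (k + 1)) | 1 ≤ ‖x‖ ∧ ‖x‖ ≤ 2} ≃ₜ
        ↥(K₂ \ interior K₁),
      (∀ x : ↥{x : EuclideanSpace ℝ (Fin (k + 1)) | 1 ≤ ‖x‖ ∧ ‖x‖ ≤ 2},
        ‖(x : EuclideanSpace ℝ (Fin (k + 1)))‖ = 1 ↔
          (F x : EuclideanSpace ℝ (Fin (k + 1))) ∈ frontier K₁) ∧
      (∀ x : ↥{x : EuclideanSpace ℝ (Fin (k + 1)) | 1 ≤ ‖x‖ ∧ ‖x‖ ≤ 2},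
        ‖(x : EuclideanSpace ℝ (Fin (k + 1)))‖ = 2 ↔
          (F x : EuclideanSpace ℝ (Fin (k + 1))) ∈ frontier K₂)) ∧
    Nonempty (↥(interior K₂ \ K₁) ≃ₜ
      ↥(Metric.sphere (0 : EuclideanSpace ℝ (Fin (k + 1))) 1) × ↥(Set.Ioo (0 : ℝ) 1)) := by
  have h₁_nhds : K₁ ∈ 𝓝 0 := mem_interior_iff_mem_nhds.1 h₁_int
  have h₂_nhds : K₂ ∈ 𝓝 0 := mem_interior_iff_mem_nhds.1 (h_sub (mem_of_mem_nhds h₁_nhds))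
  have hp := isRadialGauge_gauge h₁_compact h₁_star h₁_nhds h₁_ray
  have hq := isRadialGauge_gauge h₂_compact h₂_star h₂_nhds h₂_ray
  have hqp (x) (hx : x ≠ 0) : gauge K₂ x < gauge K₁ x := by
    have hpx := hp.pos x hx
    have h := interior_subset_gauge_lt_one K₂ (h_sub
      ((gauge_le_one_iff_mem_of_starConvex h₁_compact.isClosed h₁_star h₁_nhds).1
        (gauge_inv_smul_self hpx).le))
    rwa [mem_ofPred_eq, hq.smul _ _ (inv_nonneg.2 hpx.le), inv_mul_lt_one₀ hpx] at h
  have hn := isRadialGauge_norm (E := EuclideanSpace ℝ (Fin (k + 1)))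
  let r : EuclideanSpace ℝ (Fin (k + 1)) → ℝ := fun x ↦ ‖x‖ / 2
  have hr : IsRadialGauge r := hn.div_const two_pos
  have hrn (x) (hx : x ≠ 0) : r x < ‖x‖ :=
    half_lt_self (norm_pos_iff.2 hx)
  have hclosed (y) : y ∈ K₂ \ interior K₁ ↔
      y ≠ 0 ∧ radialPosition (gauge K₁) (gauge K₂) y ∈ Icc 0 1 := by
    rcases eq_or_ne y 0 with rfl | hy
    · simp [h₁_int]
    · rw [mem_Icc, radialPosition_nonneg_iff (hq.pos y hy) (hqp y hy),
        radialPosition_le_one_iff (hq.pos y hy) (hqp y hy), mem_sdiff,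
        ← gauge_le_one_iff_mem_of_starConvex h₂_compact.isClosed h₂_star h₂_nhds,
        ← gauge_lt_one_iff_mem_interior_of_starConvex h₁_compact h₁_star h₁_nhds h₁_ray, not_lt]
      tauto
  have hopen (y) : y ∈ interior K₂ \ K₁ ↔
      y ≠ 0 ∧ radialPosition (gauge K₁) (gauge K₂) y ∈ Ioo 0 1 := by
    rcases eq_or_ne y 0 with rfl | hy
    · simp [mem_of_mem_nhds h₁_nhds]
    · rw [mem_Ioo, radialPosition_pos_iff (hq.pos y hy) (hqp y hy),
        radialPosition_lt_one_iff (hq.pos y hy) (hqp y hy), mem_sdiff,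
        ← gauge_le_one_iff_mem_of_starConvex h₁_compact.isClosed h₁_star h₁_nhds,
        ← gauge_lt_one_iff_mem_interior_of_starConvex h₂_compact h₂_star h₂_nhds h₂_ray, not_le]
      tauto
  have hannulus (y) : y ∈ {x : EuclideanSpace ℝ (Fin (k + 1)) | 1 ≤ ‖x‖ ∧ ‖x‖ ≤ 2} ↔
      y ≠ 0 ∧ radialPosition norm r y ∈ Icc 0 1 := by
    rcases eq_or_ne y 0 with rfl | hy
    · simp
    · rw [mem_Icc, radialPosition_nonneg_iff (hr.pos y hy) (hrn y hy),
        radialPosition_le_one_iff (hr.pos y hy) (hrn y hy), show r y = ‖y‖ / 2 from rfl,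
        div_le_one two_pos, mem_ofPred_eq]
      tauto
  let Φ := radialHomeomorph hn hr hrn Subset.rfl hannulus
  let Ψ := radialHomeomorph hp hq hqp Subset.rfl hclosed
  have hpos (x) : radialPosition (gauge K₁) (gauge K₂) (Φ.trans Ψ.symm x) =
      radialPosition norm r (x : EuclideanSpace ℝ (Fin (k + 1))) := by
    rw [← radialHomeomorph_apply_snd hp hq hqp Subset.rfl hclosed,
      ← radialHomeomorph_apply_snd hn hr hrn Subset.rfl hannulus]
    exact congrArg (fun z ↦ (z.2 : ℝ)) (Ψ.apply_symm_apply (Φ x))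
  refine ⟨⟨Φ.trans Ψ.symm, fun x ↦ ?_, fun x ↦ ?_⟩,
    ⟨radialHomeomorph hp hq hqp Ioo_subset_Icc_self hopen⟩⟩
  · have hx := ((hannulus x).1 x.2).1
    have hy := ((hclosed _).1 (Φ.trans Ψ.symm x).2).1
    rw [← gauge_eq_one_iff_mem_frontier_of_starConvex h₁_compact h₁_star h₁_nhds h₁_ray,
      ← radialPosition_eq_zero_iff (hq.pos _ hy) (hqp _ hy), hpos,
      radialPosition_eq_zero_iff (hr.pos _ hx) (hrn _ hx)]
  · have hx := ((hannulus x).1 x.2).1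
    have hy := ((hclosed _).1 (Φ.trans Ψ.symm x).2).1
    rw [← gauge_eq_one_iff_mem_frontier_of_starConvex h₂_compact h₂_star h₂_nhds h₂_ray,
      ← radialPosition_eq_one_iff (hq.pos _ hy) (hqp _ hy), hpos,
      radialPosition_eq_one_iff (hr.pos _ hx) (hrn _ hx)]
    exact (div_eq_one_iff_eq two_ne_zero).symm
end

section
/- Let k ≥ 3. The set M_ind = { x ∈ ℝ^{k+1} : x_α > 0 for all α, Σ_{α=0}^{k} x_α = 1, and for every n with 3 ≤ n ≤ k, (Σ_{α=0}^{n} x₀⋯x̂_α⋯xₙ)² − (n−1)·(Σ_{α=0}^{n} x₀²⋯x̂_α²⋯xₙ²) ≥ 0 }, equipped with the subspace topology of ℝ^{k+1}, is contractible. -/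
open Finset in
/-- The set `M_ind` of strictly positive probability measures `x` on `k+1` atoms such that for
every `3 ≤ n ≤ k` the flatness condition
`(Σ_{α=0}^{n} x₀⋯x̂_α⋯xₙ)² − (n−1)·(Σ_{α=0}^{n} x₀²⋯x̂_α²⋯xₙ²) ≥ 0` holds (equivalently, by
Morgan's theorem, the space of atoms with Kolmogorov distance `d(aᵢ,aⱼ) = xᵢ + xⱼ` for `i ≠ j`
embeds isometrically into some Euclidean space `ℝ^N`). -/
def Mind (k : ℕ) : Set (Fin (k + 1) → ℝ) :=
  {x | (∀ α, 0 < x α) ∧ (∑ α, x α = 1) ∧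
    ∀ n : ℕ, 3 ≤ n → n ≤ k →
      0 ≤ (∑ α ∈ Finset.univ.filter (fun α : Fin (k + 1) => (α : ℕ) ≤ n),
              ∏ β ∈ (Finset.univ.filter (fun β : Fin (k + 1) => (β : ℕ) ≤ n)).erase α, x β) ^ 2 -
          ((n : ℝ) - 1) *
            ∑ α ∈ Finset.univ.filter (fun α : Fin (k + 1) => (α : ℕ) ≤ n),
              ∏ β ∈ (Finset.univ.filter (fun β : Fin (k + 1) => (β : ℕ) ≤ n)).erase α, (x β) ^ 2}

/-- For a vector `x` with positive entries, the flatness expression equals a positive multiple of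
the quadratic form `(∑ u)² - c ∑ u²` evaluated at the entrywise inverse `u = x⁻¹`. -/
lemma sq_sum_prod_erase_sub {ι : Type*} [DecidableEq ι] (s : Finset ι) (c : ℝ) {x : ι → ℝ}
    (hx : ∀ i, 0 < x i) :
    (∑ i ∈ s, ∏ j ∈ s.erase i, x j) ^ 2 - c * ∑ i ∈ s, ∏ j ∈ s.erase i, (x j) ^ 2 =
      (∏ j ∈ s, x j) ^ 2 * ((∑ i ∈ s, (x i)⁻¹) ^ 2 - c * ∑ i ∈ s, ((x i)⁻¹) ^ 2) := by
  have h : ∀ i ∈ s, ∏ j ∈ s.erase i, x j = (∏ j ∈ s, x j) * (x i)⁻¹ := fun i hi => by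
    rw [← Finset.prod_erase_mul s x hi, mul_inv_cancel_right₀ (hx i).ne']
  have h_sq : ∀ i ∈ s, ∏ j ∈ s.erase i, (x j) ^ 2 = (∏ j ∈ s, x j) ^ 2 * ((x i)⁻¹) ^ 2 :=
    fun i hi => by rw [Finset.prod_pow, h i hi, mul_pow]
  rw [Finset.sum_congr rfl h, Finset.sum_congr rfl h_sq, ← Finset.mul_sum, ← Finset.mul_sum]
  ring

/-- The flatness expression of a positive vector is nonnegative iff its entrywise inverse lies in
the second-order cone `c ∑ u² ≤ (∑ u)²`. -/
lemma sq_sum_prod_erase_sub_nonneg_iff {ι : Type*} [DecidableEq ι] (s : Finset ι) (c : ℝ)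
    {x : ι → ℝ} (hx : ∀ i, 0 < x i) :
    0 ≤ (∑ i ∈ s, ∏ j ∈ s.erase i, x j) ^ 2 - c * ∑ i ∈ s, ∏ j ∈ s.erase i, (x j) ^ 2 ↔
      c * ∑ i ∈ s, ((x i)⁻¹) ^ 2 ≤ (∑ i ∈ s, (x i)⁻¹) ^ 2 := by
  rw [sq_sum_prod_erase_sub s c hx,
    mul_nonneg_iff_of_pos_left (pow_pos (Finset.prod_pos fun i _ => hx i) 2), sub_nonneg]

/-- The positive part of the second-order cone `c ∑ u² ≤ (∑ u)²` is convex. -/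
lemma convex_pos_sum_sq_le_sq_sum {ι : Type*} (s : Finset ι) {c : ℝ} (hc : 0 ≤ c) :
    Convex ℝ {u : ι → ℝ | (∀ i, 0 < u i) ∧ c * ∑ i ∈ s, (u i) ^ 2 ≤ (∑ i ∈ s, u i) ^ 2} := by
  rintro u ⟨hu, hu'⟩ v ⟨hv, hv'⟩ a b ha hb hab
  refine ⟨fun i => convex_Ioi (0 : ℝ) (hu i) (hv i) ha hb hab, ?_⟩
  have hS : (∑ i ∈ s, (a • u + b • v) i) = a * ∑ i ∈ s, u i + b * ∑ i ∈ s, v i := by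
    simp [Finset.sum_add_distrib, Finset.mul_sum]
  have hQ : (∑ i ∈ s, ((a • u + b • v) i) ^ 2) =
      a ^ 2 * ∑ i ∈ s, (u i) ^ 2 + 2 * (a * b) * ∑ i ∈ s, u i * v i
        + b ^ 2 * ∑ i ∈ s, (v i) ^ 2 := by
    simp only [Finset.mul_sum, ← Finset.sum_add_distrib, Pi.add_apply, Pi.smul_apply, smul_eq_mul]
    exact Finset.sum_congr rfl fun i _ => by ring
  have hSu : 0 ≤ ∑ i ∈ s, u i := Finset.sum_nonneg fun i _ => (hu i).le
  have hSv : 0 ≤ ∑ i ∈ s, v i := Finset.sum_nonneg fun i _ => (hv i).le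
  have cross : c * ∑ i ∈ s, u i * v i ≤ (∑ i ∈ s, u i) * ∑ i ∈ s, v i := by
    refine le_of_sq_le_sq ?_ (mul_nonneg hSu hSv)
    calc (c * ∑ i ∈ s, u i * v i) ^ 2
        = c ^ 2 * (∑ i ∈ s, u i * v i) ^ 2 := mul_pow ..
      _ ≤ c ^ 2 * ((∑ i ∈ s, (u i) ^ 2) * ∑ i ∈ s, (v i) ^ 2) := by
          gcongr
          exact Finset.sum_mul_sq_le_sq_mul_sq s u v
      _ = (c * ∑ i ∈ s, (u i) ^ 2) * (c * ∑ i ∈ s, (v i) ^ 2) := by ring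
      _ ≤ (∑ i ∈ s, u i) ^ 2 * (∑ i ∈ s, v i) ^ 2 :=
          mul_le_mul hu' hv' (mul_nonneg hc (Finset.sum_nonneg fun i _ => sq_nonneg _))
            (sq_nonneg _)
      _ = _ := (mul_pow ..).symm
  rw [hS, hQ]
  have h₁ := mul_le_mul_of_nonneg_left hu' (sq_nonneg a)
  have h₂ := mul_le_mul_of_nonneg_left hv' (sq_nonneg b)
  have h₃ := mul_le_mul_of_nonneg_left cross (mul_nonneg ha hb)
  linarith

/-- A retract of a contractible space is contractible. -/
lemma ContractibleSpace.of_retract {X Y : Type*} [TopologicalSpace X] [TopologicalSpace Y]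
    [ContractibleSpace Y] (i : C(X, Y)) (r : C(Y, X)) (h : r.comp i = ContinuousMap.id X) :
    ContractibleSpace X := by
  rw [contractible_iff_id_nullhomotopic, ← h]
  exact ((id_nullhomotopic Y).comp_left i).comp_right r

/-- The cone of entrywise inverses of positive multiples of points of `Mind k`. -/
def MindInvCone (k : ℕ) : Set (Fin (k + 1) → ℝ) :=
  {u | (∀ α, 0 < u α) ∧ ∀ n : ℕ, 3 ≤ n → n ≤ k →
    ((n : ℝ) - 1) * ∑ α ∈ Finset.univ.filter (fun α : Fin (k + 1) => (α : ℕ) ≤ n), (u α) ^ 2 ≤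
      (∑ α ∈ Finset.univ.filter (fun α : Fin (k + 1) => (α : ℕ) ≤ n), u α) ^ 2}

lemma mem_Mind_iff {k : ℕ} {x : Fin (k + 1) → ℝ} :
    x ∈ Mind k ↔ x⁻¹ ∈ MindInvCone k ∧ ∑ α, x α = 1 := by
  simp only [Mind, MindInvCone, Set.mem_ofPred_eq, Pi.inv_apply, inv_pos]
  constructor
  · rintro ⟨hx, hsum, hn⟩
    exact ⟨⟨hx, fun n h₁ h₂ =>
      (sq_sum_prod_erase_sub_nonneg_iff _ _ hx).1 (hn n h₁ h₂)⟩, hsum⟩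
  · rintro ⟨⟨hx, hn⟩, hsum⟩
    exact ⟨hx, hsum, fun n h₁ h₂ =>
      (sq_sum_prod_erase_sub_nonneg_iff _ _ hx).2 (hn n h₁ h₂)⟩

lemma convex_MindInvCone (k : ℕ) : Convex ℝ (MindInvCone k) := by
  intro u hu v hv a b ha hb hab
  have key (n : ℕ) (h₁ : 3 ≤ n) (h₂ : n ≤ k) :=
    convex_pos_sum_sq_le_sq_sum (Finset.univ.filter fun α : Fin (k + 1) => (α : ℕ) ≤ n)
      (show (0 : ℝ) ≤ n - 1 from sub_nonneg.2 (by exact_mod_cast (by lia : 1 ≤ n)))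
      ⟨hu.1, hu.2 n h₁ h₂⟩ ⟨hv.1, hv.2 n h₁ h₂⟩ ha hb hab
  exact ⟨fun i => convex_Ioi (0 : ℝ) (hu.1 i) (hv.1 i) ha hb hab, fun n h₁ h₂ => (key n h₁ h₂).2⟩

lemma smul_mem_MindInvCone {k : ℕ} {u : Fin (k + 1) → ℝ} (hu : u ∈ MindInvCone k) {c : ℝ}
    (hc : 0 < c) : c • u ∈ MindInvCone k := by
  refine ⟨fun α => mul_pos hc (hu.1 α), fun n h₁ h₂ => ?_⟩
  have h := mul_le_mul_of_nonneg_left (hu.2 n h₁ h₂) (sq_nonneg c)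
  simp only [Pi.smul_apply, smul_eq_mul, mul_pow, ← Finset.mul_sum]
  linarith

lemma one_mem_MindInvCone (k : ℕ) : (1 : Fin (k + 1) → ℝ) ∈ MindInvCone k := by
  refine ⟨fun _ => one_pos, fun n _ h₂ => ?_⟩
  have hcard : (Finset.univ.filter fun α : Fin (k + 1) => (α : ℕ) ≤ n).card = n + 1 := by
    have h : (Finset.univ.filter fun α : Fin (k + 1) => (α : ℕ) ≤ n) =
        Finset.Iic ⟨n, by lia⟩ := by
      ext α
      simp [Fin.le_def]
    rw [h, Fin.card_Iic]
  simp only [Pi.one_apply, one_pow, Finset.sum_const, hcard, nsmul_eq_mul, mul_one]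
  push_cast
  nlinarith [Nat.cast_nonneg (α := ℝ) n]

lemma sum_inv_pos_of_mem_MindInvCone {k : ℕ} {u : Fin (k + 1) → ℝ} (hu : u ∈ MindInvCone k) :
    0 < ∑ α, (u α)⁻¹ :=
  Finset.sum_pos (fun α _ => inv_pos.2 (hu.1 α)) Finset.univ_nonempty

/-- Inverting entrywise and normalizing maps the cone to `Mind k`. -/
lemma smul_inv_mem_Mind {k : ℕ} {u : Fin (k + 1) → ℝ} (hu : u ∈ MindInvCone k) :
    (∑ α, (u α)⁻¹)⁻¹ • u⁻¹ ∈ Mind k := by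
  have hpos := sum_inv_pos_of_mem_MindInvCone hu
  refine mem_Mind_iff.2 ⟨?_, ?_⟩
  · have h : ((∑ α, (u α)⁻¹)⁻¹ • u⁻¹)⁻¹ = (∑ α, (u α)⁻¹) • u := by
      ext α
      simp [mul_comm]
    rw [h]
    exact smul_mem_MindInvCone hu hpos
  · simp only [Pi.smul_apply, Pi.inv_apply, smul_eq_mul, ← Finset.mul_sum]
    exact inv_mul_cancel₀ hpos.ne'

/-- For `k ≥ 3`, the space `M_ind`, with the subspace topology of `ℝ^{k+1}`,
is contractible. -/
theorem Mind_contractible (k : ℕ) (hk : 3 ≤ k) : ContractibleSpace ↥(Mind k) := by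
  have : ContractibleSpace (MindInvCone k) :=
    (convex_MindInvCone k).contractibleSpace ⟨1, one_mem_MindInvCone k⟩
  let i : C(Mind k, MindInvCone k) :=
    { toFun := fun x => ⟨(x : Fin (k + 1) → ℝ)⁻¹, (mem_Mind_iff.1 x.2).1⟩
      continuous_toFun := by
        refine Continuous.subtype_mk (continuous_pi fun α => ?_) _
        exact ((continuous_apply α).comp continuous_subtype_val).inv₀ fun x => (x.2.1 α).ne' }
  let r : C(MindInvCone k, Mind k) :=
    { toFun := fun u => ⟨_, smul_inv_mem_Mind u.2⟩
      continuous_toFun := by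
        have hinv (α : Fin (k + 1)) :
            Continuous fun u : MindInvCone k => ((u : Fin (k + 1) → ℝ) α)⁻¹ :=
          ((continuous_apply α).comp continuous_subtype_val).inv₀ fun u => (u.2.1 α).ne'
        exact Continuous.subtype_mk (((continuous_finsetSum _ fun α _ => hinv α).inv₀
          fun u => (sum_inv_pos_of_mem_MindInvCone u.2).ne').smul (continuous_pi hinv)) _ }
  refine ContractibleSpace.of_retract i r (ContinuousMap.ext fun x => Subtype.ext ?_)
  simp [i, r, x.2.2.1]
end
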